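/- arXiv:2510.10388 — 2 statements merged into one kernel-verified Lean document; each statement's English description precedes it below -/
import Mathlib

section
/- Let γ : [0,ℓ] → ℝ² be a C^∞ curve parametrized by arc length, i.e. ‖γ'(s)‖ = 1 for all s ∈ [0,ℓ]. Then the length of its front track satisfies Len(φ(γ)) = ∫_0^ℓ √(1 + ‖γ''(s)‖²) ds ≥ ℓ = Len(γ). -/
open Set intervalIntegral

noncomputable section

/-- The front-track map: `φ(γ)(t) = γ(t) + γ'(t)/‖γ'(t)‖`. -/
def frontTrack (γ : ℝ → EuclideanSpace ℝ (Fin 2)) : ℝ → EuclideanSpace ℝ (Fin 2) :=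
  fun t => γ t + ‖deriv γ t‖⁻¹ • deriv γ t

/-- At a point near which `γ` has unit speed, the front track has speed `√(1 + ‖γ''‖²)`. -/
theorem norm_deriv_frontTrack {γ : ℝ → EuclideanSpace ℝ (Fin 2)} {s : ℝ}
    (hγ : DifferentiableAt ℝ γ s) (hγ' : DifferentiableAt ℝ (deriv γ) s)
    (hunit : ∀ᶠ t in nhds s, ‖deriv γ t‖ = 1) :
    ‖deriv (frontTrack γ) s‖ = Real.sqrt (1 + ‖deriv (deriv γ) s‖ ^ 2) := by
  have hfront : frontTrack γ =ᶠ[nhds s] fun t => γ t + deriv γ t := by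
    filter_upwards [hunit] with t ht
    simp [frontTrack, ht]
  have hderiv : deriv (frontTrack γ) s = deriv γ s + deriv (deriv γ) s :=
    hfront.deriv_eq.trans (hγ.hasDerivAt.add hγ'.hasDerivAt).deriv
  have hsq : (fun t => ‖deriv γ t‖ ^ 2) =ᶠ[nhds s] fun _ => (1 : ℝ) := by
    filter_upwards [hunit] with t ht
    simp [ht]
  have horth : inner ℝ (deriv γ s) (deriv (deriv γ) s) = 0 := by
    have h := hγ'.hasDerivAt.norm_sq.deriv
    rw [hsq.deriv_eq, deriv_const] at h
    linarith
  rw [hderiv, eq_comm, Real.sqrt_eq_iff_mul_self_eq (by positivity) (norm_nonneg _),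
    norm_add_sq_eq_norm_sq_add_norm_sq_of_inner_eq_zero _ _ horth, hunit.self_of_nhds]
  ring

/-- For a `C^∞` curve `γ : [0,ℓ] → ℝ²` parametrized by arc length,
`Len(φ(γ)) = ∫_0^ℓ √(1 + ‖γ''(s)‖²) ds ≥ ℓ = Len(γ)`. -/
theorem frontTrack_length_eq_and_ge (ℓ : ℝ) (hℓ : 0 < ℓ)
    (γ : ℝ → EuclideanSpace ℝ (Fin 2)) (hsmooth : ContDiff ℝ (⊤ : ℕ∞) γ)
    (harc : ∀ s ∈ Icc (0:ℝ) ℓ, ‖deriv γ s‖ = 1) :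
    (∫ s in (0:ℝ)..ℓ, ‖deriv (frontTrack γ) s‖)
      = (∫ s in (0:ℝ)..ℓ, Real.sqrt (1 + ‖deriv (deriv γ) s‖ ^ 2)) ∧
    ℓ ≤ ∫ s in (0:ℝ)..ℓ, Real.sqrt (1 + ‖deriv (deriv γ) s‖ ^ 2) ∧
    (∫ s in (0:ℝ)..ℓ, ‖deriv γ s‖) = ℓ := by
  have hγ' : ContDiff ℝ (⊤ : ℕ∞) (deriv γ) := (contDiff_infty_iff_deriv.mp hsmooth).2
  have hγ'' : Continuous (deriv (deriv γ)) :=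
    (contDiff_infty_iff_deriv.mp hγ').2.continuous
  refine ⟨?_, ?_, ?_⟩
  · refine integral_congr_Ioo_of_le hℓ.le fun s hs => ?_
    refine norm_deriv_frontTrack (hsmooth.differentiable (by simp) s)
      (hγ'.differentiable (by simp) s) ?_
    filter_upwards [Icc_mem_nhds hs.1 hs.2] with t ht using harc t ht
  · calc ℓ = ∫ _ in (0:ℝ)..ℓ, (1 : ℝ) := by simp
      _ ≤ _ := by
        refine integral_mono_on hℓ.le (by simp) (Continuous.intervalIntegrable (by fun_prop) _ _)
          fun s _ => ?_
        rw [Real.one_le_sqrt]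
        exact le_add_of_nonneg_right (sq_nonneg _)
  · rw [integral_congr (g := fun _ => (1 : ℝ)) fun s hs => harc s (uIcc_of_le hℓ.le ▸ hs)]
    simp
end
end

section
/- Let γ : [0,ℓ] → ℝ² be a C^∞ curve parametrized by arc length (‖γ'(s)‖ = 1 for all s) and suppose γ''(s₀) ≠ 0 for some s₀ ∈ [0,ℓ]. Then Len(φ(γ)) > Len(γ); that is, the length strictly increases under φ unless γ is a straight line segment. -/
open Set intervalIntegral

noncomputable section

/-- A curve of unit norm on a nondegenerate interval is orthogonal to its derivative there,
endpoints included. -/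
lemma inner_deriv_eq_zero_of_norm_eq_one {E : Type*} [NormedAddCommGroup E]
    [InnerProductSpace ℝ E] {a b : ℝ} (hab : a < b) {v : ℝ → E} (hv : Differentiable ℝ v)
    (hnorm : ∀ s ∈ Icc a b, ‖v s‖ = 1) {s : ℝ} (hs : s ∈ Icc a b) :
    inner ℝ (v s) (deriv v s) = 0 := by
  have hsq : HasDerivWithinAt (fun t => ‖v t‖ ^ 2) (2 * inner ℝ (v s) (deriv v s)) (Icc a b) s :=
    (hv s).hasDerivAt.norm_sq.hasDerivWithinAt
  have hconst : HasDerivWithinAt (fun t => ‖v t‖ ^ 2) 0 (Icc a b) s :=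
    (hasDerivWithinAt_const s (Icc a b) (1 : ℝ)).congr
      (fun t ht => by simp [hnorm t ht]) (by simp [hnorm s hs])
  have := (uniqueDiffOn_Icc hab s hs).eq_deriv (Icc a b) hsq hconst
  linarith

/-- On the open interval where `γ` has unit speed, `φ(γ)' = γ' + γ''`. -/
lemma deriv_frontTrack_of_norm_deriv_eq_one {a b : ℝ} {γ : ℝ → EuclideanSpace ℝ (Fin 2)}
    (hγ : Differentiable ℝ γ) (hγ' : Differentiable ℝ (deriv γ))
    (harc : ∀ s ∈ Icc a b, ‖deriv γ s‖ = 1) {s : ℝ} (hs : s ∈ Ioo a b) :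
    deriv (frontTrack γ) s = deriv γ s + deriv (deriv γ) s := by
  have heq : frontTrack γ =ᶠ[nhds s] fun t => γ t + deriv γ t := by
    filter_upwards [isOpen_Ioo.mem_nhds hs] with t ht
    simp [frontTrack, harc t (Ioo_subset_Icc_self ht)]
  rw [heq.deriv_eq]
  exact deriv_fun_add (hγ s) (hγ' s)

/-- If a `C^∞` arc-length parametrized curve `γ : [0,ℓ] → ℝ²` has
`γ''(s₀) ≠ 0` for some `s₀ ∈ [0,ℓ]`, then `Len(φ(γ)) > Len(γ)`. -/
theorem frontTrack_length_strict_gt (ℓ : ℝ) (hℓ : 0 < ℓ)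
    (γ : ℝ → EuclideanSpace ℝ (Fin 2)) (hsmooth : ContDiff ℝ (⊤ : ℕ∞) γ)
    (harc : ∀ s ∈ Icc (0:ℝ) ℓ, ‖deriv γ s‖ = 1)
    (s₀ : ℝ) (hs₀ : s₀ ∈ Icc (0:ℝ) ℓ) (hcurv : deriv (deriv γ) s₀ ≠ 0) :
    (∫ s in (0:ℝ)..ℓ, ‖deriv γ s‖) < ∫ s in (0:ℝ)..ℓ, ‖deriv (frontTrack γ) s‖ := by
  have hγ : Differentiable ℝ γ := hsmooth.differentiable (by simp)
  have hsmooth' : ContDiff ℝ (⊤ : ℕ∞) (deriv γ) := (contDiff_infty_iff_deriv.mp hsmooth).2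
  have hγ' : Differentiable ℝ (deriv γ) := hsmooth'.differentiable (by simp)
  have hcont'' : Continuous (deriv (deriv γ)) := (contDiff_infty_iff_deriv.mp hsmooth').2.continuous
  have hpyth : ∀ s ∈ Icc (0:ℝ) ℓ,
      ‖deriv γ s + deriv (deriv γ) s‖ ^ 2 = 1 + ‖deriv (deriv γ) s‖ ^ 2 := fun s hs => by
    rw [norm_add_sq_real, inner_deriv_eq_zero_of_norm_eq_one hℓ hγ' harc hs, harc s hs]
    ring
  have hcongr : (∫ s in (0:ℝ)..ℓ, ‖deriv (frontTrack γ) s‖) =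
      ∫ s in (0:ℝ)..ℓ, ‖deriv γ s + deriv (deriv γ) s‖ := by
    rw [integral_of_le hℓ.le, integral_of_le hℓ.le, MeasureTheory.integral_Ioc_eq_integral_Ioo,
      MeasureTheory.integral_Ioc_eq_integral_Ioo]
    exact MeasureTheory.setIntegral_congr_fun measurableSet_Ioo fun s hs => by
      simp only [deriv_frontTrack_of_norm_deriv_eq_one hγ hγ' harc hs]
  rw [hcongr]
  refine integral_lt_integral_of_continuousOn_of_le_of_exists_lt hℓ
    hγ'.continuous.norm.continuousOn (hγ'.continuous.add hcont'').norm.continuousOn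
    (fun s hs => ?_) ⟨s₀, hs₀, ?_⟩
  · have hs' := Ioc_subset_Icc_self hs
    rw [harc s hs']
    nlinarith [hpyth s hs', norm_nonneg (deriv γ s + deriv (deriv γ) s)]
  · rw [harc s₀ hs₀]
    have := norm_pos_iff.mpr hcurv
    nlinarith [hpyth s₀ hs₀, norm_nonneg (deriv γ s₀ + deriv (deriv γ) s₀)]
end
end
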